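/- arXiv:2001.02992 — 2 statements merged into one kernel-verified Lean document; each statement's English description precedes it below -/
import Mathlib

section
/- Let 𝒳 be a nonempty finite set, P_𝒳 a probability measure on 𝒳, P_ℱ a probability measure on the set of functions 𝒳 → {−1,1}, and m ≥ 1. Let (X,F) ∼ P_𝒳 × P_ℱ, Y = F(X), g : 𝒳 × {−1,1} → [m], and W = g(X,Y). Then ∑_{i∈[m]} ∑_f (P(W = i, F = f) − P(W = i)·P(F = f))² ≤ (max_f P_ℱ(f)) · √(CP(P_𝒳, P_ℱ)), where the inner sum ranges over all functions f : 𝒳 → {−1,1}. -/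
open Finset

/-- Cross-predictability of a distribution `pF` on sign-valued functions with respect to an
input distribution `pX` on a finite set `𝒳`. Signs are encoded as `ℤˣ = {±1}`. -/
noncomputable def cp {𝒳 : Type*} [Fintype 𝒳] [DecidableEq 𝒳] (pX : 𝒳 → ℝ)
    (pF : (𝒳 → ℤˣ) → ℝ) : ℝ :=
  ∑ F : 𝒳 → ℤˣ, ∑ F' : 𝒳 → ℤˣ, pF F * pF F' *
    (∑ x : 𝒳, pX x * (((F x : ℤ) : ℝ) * ((F' x : ℤ) : ℝ))) ^ 2

/-- Among all centres `a`, the weighted mean minimises the weighted sum of squared deviations. -/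
theorem sum_mul_sub_mean_sq_le {ι : Type*} [Fintype ι] (w p : ι → ℝ) (hw : ∑ i, w i = 1) (a : ℝ) :
    ∑ i, w i * (p i - ∑ j, w j * p j) ^ 2 ≤ ∑ i, w i * (p i - a) ^ 2 := by
  have expand (c : ℝ) : ∑ i, w i * (p i - c) ^ 2
      = ∑ i, w i * p i ^ 2 - 2 * c * ∑ i, w i * p i + c ^ 2 := by
    calc ∑ i, w i * (p i - c) ^ 2
        = ∑ i, (w i * p i ^ 2 - 2 * c * (w i * p i) + c ^ 2 * w i) :=
          sum_congr rfl fun i _ => by ring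
      _ = _ := by rw [sum_add_distrib, sum_sub_distrib, ← mul_sum, ← mul_sum, hw, mul_one]
  rw [expand, expand]
  nlinarith [sq_nonneg (∑ i, w i * p i - a)]

/-- The correlation of the labels at `x` and `y` under a random function drawn from `pF`. -/
noncomputable def labelCorr {𝒳 : Type*} [Fintype 𝒳] [DecidableEq 𝒳] (pF : (𝒳 → ℤˣ) → ℝ)
    (x y : 𝒳) : ℝ :=
  ∑ f : 𝒳 → ℤˣ, pF f * (((f x : ℤ) : ℝ) * ((f y : ℤ) : ℝ))

theorem sum_mul_sum_sq_eq_labelCorr {𝒳 : Type*} [Fintype 𝒳] [DecidableEq 𝒳]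
    (pF : (𝒳 → ℤˣ) → ℝ) (u : 𝒳 → ℝ) :
    ∑ f : 𝒳 → ℤˣ, pF f * (∑ x, u x * ((f x : ℤ) : ℝ)) ^ 2
      = ∑ x, ∑ y, u x * u y * labelCorr pF x y := by
  simp only [sq, sum_mul_sum]
  simp only [labelCorr, mul_sum]
  rw [sum_comm]
  refine sum_congr rfl fun x _ => ?_
  rw [sum_comm]
  exact sum_congr rfl fun y _ => sum_congr rfl fun f _ => by ring

theorem cp_eq_sum_labelCorr_sq {𝒳 : Type*} [Fintype 𝒳] [DecidableEq 𝒳] (pX : 𝒳 → ℝ)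
    (pF : (𝒳 → ℤˣ) → ℝ) :
    cp pX pF = ∑ x, ∑ y, pX x * pX y * labelCorr pF x y ^ 2 := by
  calc cp pX pF
      = ∑ F : 𝒳 → ℤˣ, pF F * ∑ F' : 𝒳 → ℤˣ,
          pF F' * (∑ x, (pX x * ((F x : ℤ) : ℝ)) * ((F' x : ℤ) : ℝ)) ^ 2 := by
        simp only [cp, mul_sum, mul_assoc]
    _ = ∑ F : 𝒳 → ℤˣ, ∑ x, ∑ y, pX x * pX y * labelCorr pF x y *
          (pF F * (((F x : ℤ) : ℝ) * ((F y : ℤ) : ℝ))) := by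
        refine sum_congr rfl fun F _ => ?_
        rw [sum_mul_sum_sq_eq_labelCorr]
        simp only [mul_sum]
        exact sum_congr rfl fun x _ => sum_congr rfl fun y _ => by ring
    _ = ∑ x, ∑ y, pX x * pX y * labelCorr pF x y ^ 2 := by
        rw [sum_comm]
        refine sum_congr rfl fun x _ => ?_
        rw [sum_comm]
        refine sum_congr rfl fun y _ => ?_
        rw [← mul_sum, ← labelCorr]
        ring

theorem sum_abs_labelCorr_le_sqrt_cp {𝒳 : Type*} [Fintype 𝒳] [DecidableEq 𝒳] (pX : 𝒳 → ℝ)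
    (hpX0 : ∀ x, 0 ≤ pX x) (hpX1 : ∑ x : 𝒳, pX x = 1) (pF : (𝒳 → ℤˣ) → ℝ) :
    ∑ x, ∑ y, pX x * pX y * |labelCorr pF x y| ≤ Real.sqrt (cp pX pF) := by
  apply Real.le_sqrt_of_sq_le
  have cauchy := sum_sq_le_sum_mul_sum_of_sq_le_mul (univ : Finset (𝒳 × 𝒳))
    (r := fun z => pX z.1 * pX z.2 * |labelCorr pF z.1 z.2|)
    (f := fun z => pX z.1 * pX z.2)
    (g := fun z => pX z.1 * pX z.2 * labelCorr pF z.1 z.2 ^ 2)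
    (fun z _ => mul_nonneg (hpX0 _) (hpX0 _))
    (fun z _ => mul_nonneg (mul_nonneg (hpX0 _) (hpX0 _)) (sq_nonneg _))
    (fun z _ => by rw [mul_pow, sq_abs]; exact le_of_eq (by ring))
  simp only [Fintype.sum_prod_type] at cauchy
  rwa [← sum_mul_sum, hpX1, one_mul, one_mul, ← cp_eq_sum_labelCorr_sq] at cauchy

/-- Half the difference of the indicators of two points. -/
noncomputable def halfIndicatorDiff {ι : Type*} [DecidableEq ι] (a b i : ι) : ℝ :=
  ((if a = i then 1 else 0) - (if b = i then 1 else 0)) / 2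

theorem abs_sum_halfIndicatorDiff_mul_le_one {ι : Type*} [Fintype ι] [DecidableEq ι]
    (a b c d : ι) :
    |∑ i, halfIndicatorDiff a b i * halfIndicatorDiff c d i| ≤ 1 := by
  calc |∑ i, halfIndicatorDiff a b i * halfIndicatorDiff c d i|
      ≤ ∑ i, |halfIndicatorDiff a b i * halfIndicatorDiff c d i| := abs_sum_le_sum_abs _ _
    _ ≤ ∑ i, ((if a = i then (1 : ℝ) else 0) + (if b = i then 1 else 0)) / 2 := by
        refine sum_le_sum fun i _ => ?_
        unfold halfIndicatorDiff
        split_ifs <;> norm_num [abs_le]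
    _ = 1 := by simp [← sum_div, sum_add_distrib]

/-- for `(X,F) ∼ P_𝒳 × P_ℱ`, `Y = F(X)`, `g : 𝒳 × {±1} → [m]`, `W = g(X,Y)`:
`∑_{i∈[m]} ∑_f (P(W=i, F=f) − P(W=i)P(F=f))² ≤ (max_f P_ℱ(f)) · √CP(P_𝒳,P_ℱ)`.
Here `PWc i f = P(W=i|F=f)`, so `P(W=i,F=f) = pF f · PWc i f`, and `PW i = P(W=i)`. -/
theorem joint_distribution_l2_bound {𝒳 : Type*} [Fintype 𝒳] [DecidableEq 𝒳] [Nonempty 𝒳]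
    (pX : 𝒳 → ℝ) (hpX0 : ∀ x, 0 ≤ pX x) (hpX1 : ∑ x : 𝒳, pX x = 1)
    (pF : (𝒳 → ℤˣ) → ℝ) (hpF0 : ∀ F, 0 ≤ pF F) (hpF1 : ∑ F : 𝒳 → ℤˣ, pF F = 1)
    (m : ℕ) (hm : 1 ≤ m) (g : 𝒳 × ℤˣ → Fin m)
    (PWc : Fin m → (𝒳 → ℤˣ) → ℝ)
    (hPWc : ∀ i f, PWc i f = ∑ x : 𝒳, pX x * (if g (x, f x) = i then (1 : ℝ) else 0))
    (PW : Fin m → ℝ) (hPW : ∀ i, PW i = ∑ f : 𝒳 → ℤˣ, pF f * PWc i f) :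
    ∑ i : Fin m, ∑ f : 𝒳 → ℤˣ, (pF f * PWc i f - PW i * pF f) ^ 2
      ≤ (⨆ f : 𝒳 → ℤˣ, pF f) * Real.sqrt (cp pX pF) := by
  have hM : ∀ f, pF f ≤ ⨆ f : 𝒳 → ℤˣ, pF f := le_ciSup (Set.finite_range pF).bddAbove
  have hM0 : 0 ≤ ⨆ f : 𝒳 → ℤˣ, pF f := (hpF0 1).trans (hM 1)
  let d : Fin m → 𝒳 → ℝ := fun i x => halfIndicatorDiff (g (x, 1)) (g (x, -1)) i
  have variance_le (i : Fin m) : ∑ f : 𝒳 → ℤˣ, pF f * (PWc i f - PW i) ^ 2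
      ≤ ∑ x, ∑ y, pX x * d i x * (pX y * d i y) * labelCorr pF x y := by
    let A : ℝ := ∑ x, pX x *
      (((if g (x, 1) = i then 1 else 0) + (if g (x, -1) = i then 1 else 0)) / 2)
    have centred (f : 𝒳 → ℤˣ) : PWc i f - A = ∑ x, pX x * d i x * ((f x : ℤ) : ℝ) := by
      rw [hPWc, ← sum_sub_distrib]
      refine sum_congr rfl fun x _ => ?_
      rcases Int.units_eq_one_or (f x) with h | h <;>
        simp only [h, d, halfIndicatorDiff, Units.val_neg, Units.val_one, Int.cast_neg,
          Int.cast_one] <;> ring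
    have h := sum_mul_sub_mean_sq_le pF (PWc i) hpF1 A
    simp only [centred] at h
    rwa [← hPW, sum_mul_sum_sq_eq_labelCorr] at h
  calc ∑ i : Fin m, ∑ f : 𝒳 → ℤˣ, (pF f * PWc i f - PW i * pF f) ^ 2
      ≤ ∑ i : Fin m, ∑ f : 𝒳 → ℤˣ, (⨆ f : 𝒳 → ℤˣ, pF f) * (pF f * (PWc i f - PW i) ^ 2) := by
        refine sum_le_sum fun i _ => sum_le_sum fun f _ => ?_
        calc (pF f * PWc i f - PW i * pF f) ^ 2
            = pF f * (pF f * (PWc i f - PW i) ^ 2) := by ring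
          _ ≤ _ := mul_le_mul_of_nonneg_right (hM f) (mul_nonneg (hpF0 f) (sq_nonneg _))
    _ = (⨆ f : 𝒳 → ℤˣ, pF f) * ∑ i : Fin m, ∑ f : 𝒳 → ℤˣ, pF f * (PWc i f - PW i) ^ 2 := by
        simp only [mul_sum]
    _ ≤ (⨆ f : 𝒳 → ℤˣ, pF f) * Real.sqrt (cp pX pF) := by
        refine mul_le_mul_of_nonneg_left ?_ hM0
        refine (sum_le_sum fun i _ => variance_le i).trans ?_
        refine le_trans ?_ (sum_abs_labelCorr_le_sqrt_cp pX hpX0 hpX1 pF)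
        rw [sum_comm]
        refine sum_le_sum fun x _ => ?_
        rw [sum_comm]
        refine sum_le_sum fun y _ => ?_
        calc ∑ i, pX x * d i x * (pX y * d i y) * labelCorr pF x y
            = pX x * pX y * ((∑ i, d i x * d i y) * labelCorr pF x y) := by
              simp only [mul_sum, sum_mul]
              exact sum_congr rfl fun i _ => by ring
          _ ≤ pX x * pX y * |labelCorr pF x y| := by
              refine mul_le_mul_of_nonneg_left ?_ (mul_nonneg (hpX0 x) (hpX0 y))
              refine (le_abs_self _).trans ?_
              rw [abs_mul]
              exact mul_le_of_le_one_left (abs_nonneg _)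
                (abs_sum_halfIndicatorDiff_mul_le_one _ _ _ _)
end

section
/- Let n, m ≥ 1, and for each z ∈ {−1,1}^{n+1} let f_z : ℝ^m → [0,∞) be a measurable probability density (∫ f_z = 1). Define f⋆ = 2^{−n−1} ∑_{z ∈ {−1,1}^{n+1}} f_z, and for each s ⊆ [n] define f⋆_s = 2^{−n} ∑_{x ∈ {−1,1}^n} f_{(x, p_s(x))}. Then 2^{−n} ∑_{s⊆[n]} ∫_{ℝ^m} |f⋆(w) − f⋆_s(w)| dw ≤ 2^{−n/2} ∫_{ℝ^m} max_{z ∈ {−1,1}^{n+1}} f_z(w) dw. -/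
open MeasureTheory Finset

/-- Orthogonality of the parity functions, summed over all parities. -/
lemma sum_parity_mul_parity {ι : Type*} [Fintype ι] [DecidableEq ι] (x y : ι → ℤˣ) :
    ∑ s : Finset ι, (∏ i ∈ s, ((x i : ℤ) : ℝ)) * ∏ i ∈ s, ((y i : ℤ) : ℝ)
      = if x = y then 2 ^ Fintype.card ι else 0 := by
  simp_rw [← Finset.prod_mul_distrib]
  rw [← Finset.powerset_univ, ← Finset.prod_one_add]
  split_ifs with h
  · subst h
    have h_two (i : ι) : 1 + ((x i : ℤ) : ℝ) * ((x i : ℤ) : ℝ) = 2 := by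
      rcases Int.units_eq_one_or (x i) with h | h <;> simp [h] <;> norm_num
    simp [h_two]
  · obtain ⟨i, hi⟩ := Function.ne_iff.mp h
    refine Finset.prod_eq_zero (Finset.mem_univ i) ?_
    rcases Int.units_eq_one_or (x i) with hx | hx <;>
      rcases Int.units_eq_one_or (y i) with hy | hy <;> simp_all

/-- Parseval's identity on the Boolean cube. -/
lemma sum_sq_sum_mul_parity {ι : Type*} [Fintype ι] [DecidableEq ι] (g : (ι → ℤˣ) → ℝ) :
    ∑ s : Finset ι, (∑ x, g x * ∏ i ∈ s, ((x i : ℤ) : ℝ)) ^ 2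
      = 2 ^ Fintype.card ι * ∑ x, g x ^ 2 := by
  calc
    _ = ∑ s : Finset ι, ∑ x, ∑ y, g x * g y *
          ((∏ i ∈ s, ((x i : ℤ) : ℝ)) * ∏ i ∈ s, ((y i : ℤ) : ℝ)) := by
      refine Finset.sum_congr rfl fun s _ => ?_
      rw [sq, Finset.sum_mul_sum]
      exact Finset.sum_congr rfl fun x _ => Finset.sum_congr rfl fun y _ => by ring
    _ = ∑ x, ∑ y, g x * g y * if x = y then 2 ^ Fintype.card ι else 0 := by
      rw [Finset.sum_comm]
      refine Finset.sum_congr rfl fun x _ => ?_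
      rw [Finset.sum_comm]
      refine Finset.sum_congr rfl fun y _ => ?_
      rw [← Finset.mul_sum, sum_parity_mul_parity]
    _ = _ := by
      rw [Finset.mul_sum]
      refine Finset.sum_congr rfl fun x _ => ?_
      simp only [mul_ite, mul_zero, Finset.sum_ite_eq, Finset.mem_univ, if_true]
      ring

/-- The average magnitude of the parity coefficients of a bounded function. -/
lemma sum_abs_sum_mul_parity_le {ι : Type*} [Fintype ι] [DecidableEq ι] (g : (ι → ℤˣ) → ℝ)
    {M : ℝ} (hM : 0 ≤ M) (hg : ∀ x, |g x| ≤ M) :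
    ∑ s : Finset ι, |∑ x, g x * ∏ i ∈ s, ((x i : ℤ) : ℝ)|
      ≤ 2 ^ Fintype.card ι * √(2 ^ Fintype.card ι) * M := by
  refine abs_le_of_sq_le_sq' ?_ (by positivity) |>.2
  have h_sum : ∑ x, g x ^ 2 ≤ 2 ^ Fintype.card ι * M ^ 2 := by
    calc
      _ ≤ ∑ _x : ι → ℤˣ, M ^ 2 :=
        Finset.sum_le_sum fun x _ => sq_le_sq' (abs_le.mp (hg x)).1 (abs_le.mp (hg x)).2
      _ = _ := by simp
  calc
    _ ≤ (2 : ℝ) ^ Fintype.card ι *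
          ∑ s : Finset ι, |∑ x, g x * ∏ i ∈ s, ((x i : ℤ) : ℝ)| ^ 2 := by
      simpa using sq_sum_le_card_mul_sum_sq (s := (Finset.univ : Finset (Finset ι)))
        (f := fun s => |∑ x, g x * ∏ i ∈ s, ((x i : ℤ) : ℝ)|)
    _ ≤ 2 ^ Fintype.card ι * (2 ^ Fintype.card ι * (2 ^ Fintype.card ι * M ^ 2)) := by
      simp_rw [sq_abs]
      rw [sum_sq_sum_mul_parity]
      gcongr
    _ = _ := by
      rw [mul_pow, mul_pow, Real.sq_sqrt (by positivity)]
      ring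

/-- The uniform mixture minus a parity mixture is a parity coefficient of half the difference
between the two label classes. -/
lemma mixture_sub_parity_mixture {n : ℕ} (a : (Fin n → ℤˣ) × ℤˣ → ℝ) (s : Finset (Fin n)) :
    (∑ z, a z) / 2 ^ (n + 1) - (∑ x : Fin n → ℤˣ, a (x, ∏ i ∈ s, x i)) / 2 ^ n
      = (∑ x, (a (x, -1) - a (x, 1)) / 2 * ∏ i ∈ s, ((x i : ℤ) : ℝ)) / 2 ^ n := by
  have h_label (x : Fin n → ℤˣ) : ∑ u : ℤˣ, a (x, u) = a (x, 1) + a (x, -1) := by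
    simp [UnitsInt.univ]
  rw [Fintype.sum_prod_type, pow_succ', ← div_div, ← sub_div, Finset.sum_div,
    ← Finset.sum_sub_distrib]
  congr 1
  refine Finset.sum_congr rfl fun x _ => ?_
  have h_cast : ∏ i ∈ s, ((x i : ℤ) : ℝ) = (((∏ i ∈ s, x i : ℤˣ) : ℤ) : ℝ) := by
    push_cast
    rfl
  rw [h_label, h_cast]
  rcases Int.units_eq_one_or (∏ i ∈ s, x i) with h | h <;> rw [h] <;> push_cast <;> ring

lemma mean_abs_mixture_sub_parity_mixture_le {n : ℕ} (a : (Fin n → ℤˣ) × ℤˣ → ℝ)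
    (ha : ∀ z, 0 ≤ a z) :
    (1 / 2 ^ n) * ∑ s : Finset (Fin n),
        |(∑ z, a z) / 2 ^ (n + 1) - (∑ x : Fin n → ℤˣ, a (x, ∏ i ∈ s, x i)) / 2 ^ n|
      ≤ (1 / √(2 ^ n)) * ⨆ z, a z := by
  have h_le (z) : a z ≤ ⨆ z, a z := le_ciSup (Set.finite_range a).bddAbove z
  have hM : 0 ≤ ⨆ z, a z := Real.iSup_nonneg ha
  have h_bound := sum_abs_sum_mul_parity_le (fun x : Fin n → ℤˣ => (a (x, -1) - a (x, 1)) / 2)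
    hM fun x => abs_le.mpr (by
      constructor <;>
        linarith [h_le (x, 1), h_le (x, -1), ha (x, 1), ha (x, -1)])
  simp_rw [mixture_sub_parity_mixture, abs_div, ← Finset.sum_div]
  rw [abs_of_pos (by positivity : (0 : ℝ) < 2 ^ n)]
  rw [Fintype.card_fin] at h_bound
  have h_sqrt : √((2 : ℝ) ^ n) * √(2 ^ n) = 2 ^ n := Real.mul_self_sqrt (by positivity)
  calc
    _ ≤ 1 / 2 ^ n * (2 ^ n * √(2 ^ n) * (⨆ z, a z) / 2 ^ n) := by gcongr
    _ = _ := by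
      have h_pos : 0 < √((2 : ℝ) ^ n) := by positivity
      field_simp
      rw [sq, h_sqrt]

/-- for measurable probability densities `f_z` on `ℝ^m` indexed by
`z ∈ {−1,1}^{n+1}`, with `f⋆ = 2^{−n−1}∑_z f_z` and `f⋆_s = 2^{−n}∑_x f_{(x,p_s(x))}`,
`2^{−n} ∑_{s⊆[n]} ∫ |f⋆ − f⋆_s| ≤ 2^{−n/2} ∫ max_z f_z` (signs encoded as `ℤˣ = {±1}`). -/
theorem mixture_density_l1_bound (n m : ℕ) (hn : 1 ≤ n) (hm : 1 ≤ m)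
    (f : (Fin n → ℤˣ) × ℤˣ → (Fin m → ℝ) → ℝ)
    (hmeas : ∀ z, Measurable (f z))
    (hnonneg : ∀ z w, 0 ≤ f z w)
    (hprob : ∀ z, ∫ w : Fin m → ℝ, f z w = 1) :
    (1 / 2 ^ n) * ∑ s : Finset (Fin n),
        ∫ w : Fin m → ℝ,
          |(∑ z : (Fin n → ℤˣ) × ℤˣ, f z w) / 2 ^ (n + 1)
            - (∑ x : Fin n → ℤˣ, f (x, ∏ i ∈ s, x i) w) / 2 ^ n|
      ≤ (1 / Real.sqrt (2 ^ n)) *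
          ∫ w : Fin m → ℝ, ⨆ z : (Fin n → ℤˣ) × ℤˣ, f z w := by
  have h_int (z) : Integrable (f z) := by
    by_contra h
    simpa [integral_undef h] using hprob z
  have h_int_abs (s : Finset (Fin n)) : Integrable fun w : Fin m → ℝ =>
      |(∑ z : (Fin n → ℤˣ) × ℤˣ, f z w) / 2 ^ (n + 1)
        - (∑ x : Fin n → ℤˣ, f (x, ∏ i ∈ s, x i) w) / 2 ^ n| :=
    (((integrable_finsetSum _ fun z _ => h_int z).div_const _).sub
      ((integrable_finsetSum _ fun x _ => h_int _).div_const _)).abs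
  have h_int_sup : Integrable fun w : Fin m → ℝ => ⨆ z, f z w := by
    refine (integrable_finsetSum univ fun z _ => h_int z).mono'
      (Measurable.iSup hmeas).aestronglyMeasurable (ae_of_all _ fun w => ?_)
    rw [Real.norm_of_nonneg (Real.iSup_nonneg fun z => hnonneg z w)]
    exact ciSup_le fun z =>
      single_le_sum (f := fun z => f z w) (fun z _ => hnonneg z w) (mem_univ z)
  rw [← integral_finsetSum _ fun s _ => h_int_abs s, ← integral_const_mul, ← integral_const_mul]
  exact integral_mono ((integrable_finsetSum _ fun s _ => h_int_abs s).const_mul _)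
    (h_int_sup.const_mul _)
    fun w => mean_abs_mixture_sub_parity_mixture_le (fun z => f z w) fun z => hnonneg z w
end
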